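/- arXiv:2111.07595 — 2 statements merged into one kernel-verified Lean document; each statement's English description precedes it below -/
import Mathlib

section
/- Let p be an odd prime with p ≡ 3 (mod 4). Then the sum over k from 0 to p-1 of (6k+1)·(1/2)_k^3·(1/4)_k / (k!^4 · 4^k) is congruent to 0 modulo p^4. -/
/-- The rising factorial (Pochhammer symbol) `(x)_k = x(x+1)⋯(x+k-1)`. -/
def risingFac (x : ℚ) (k : ℕ) : ℚ := ∏ i ∈ Finset.range k, (x + i)

theorem risingFac_succ (x : ℚ) (k : ℕ) : risingFac x (k + 1) = risingFac x k * (x + k) := by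
  simp [risingFac, Finset.prod_range_succ]

theorem mul_risingFac_add_one (x : ℚ) (k : ℕ) :
    x * risingFac (x + 1) k = risingFac x k * (x + k) := by
  induction k with
  | zero => simp [risingFac]
  | succ k ih => rw [risingFac_succ, risingFac_succ, ← mul_assoc, ih]; push_cast; ring

theorem risingFac_ne_zero {x : ℚ} (hx : ∀ i : ℕ, x + i ≠ 0) (k : ℕ) : risingFac x k ≠ 0 :=
  Finset.prod_ne_zero_iff.mpr fun i _ => hx i

theorem risingFac_neg_eq_zero {n k : ℕ} (h : n < k) : risingFac (-n) k = 0 :=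
  Finset.prod_eq_zero (Finset.mem_range.mpr h) (by simp)

/-- The hypergeometric term of the quadratic summation, without its linear factor `a + 3k`. -/
def quadTerm (a b : ℚ) (k : ℕ) : ℚ :=
  risingFac a k * risingFac b k * risingFac (1 - b) k * risingFac (a / 2) k /
    ((k.factorial : ℚ) ^ 2 * risingFac (1 + (a - b) / 2) k * risingFac ((a + b + 1) / 2) k * 4 ^ k)

/-- The partial sums of the quadratic summation, up to a factor `a`. -/
def quadSum (a b : ℚ) (K : ℕ) : ℚ := ∑ k ∈ Finset.range K, (a + 3 * k) * quadTerm a b k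

theorem quadTerm_one_sub (a b : ℚ) (k : ℕ) : quadTerm a (1 - b) k = quadTerm a b k := by
  have h₁ : 1 + (a - (1 - b)) / 2 = (a + b + 1) / 2 := by ring
  have h₂ : (a + (1 - b) + 1) / 2 = 1 + (a - b) / 2 := by ring
  rw [quadTerm, quadTerm, h₁, h₂, sub_sub_cancel]
  ring

theorem quadTerm_succ (a b : ℚ) (k : ℕ) :
    quadTerm a b (k + 1) = quadTerm a b k *
      ((a + k) * (b + k) * (1 - b + k) * (a / 2 + k) /
        ((k + 1) ^ 2 * (1 + (a - b) / 2 + k) * ((a + b + 1) / 2 + k) * 4)) := by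
  simp only [quadTerm, risingFac_succ, Nat.factorial_succ, pow_succ (4 : ℚ)]
  rw [div_mul_div_comm]
  push_cast
  congr 1 <;> ring

set_option maxHeartbeats 1000000 in
theorem quadTerm_add_two (a b : ℚ) (ha : a ≠ 0) (h₁ : ∀ i : ℕ, 1 + (a - b) / 2 + i ≠ 0)
    (h₂ : ∀ i : ℕ, (a + b + 1) / 2 + i ≠ 0) (k : ℕ) :
    a * (1 + a) * quadTerm (a + 2) b k =
      (a + 2 - b) * (1 + a + b) * quadTerm a b k * ((a + k) * (a + k + 1) * (a + 2 * k)) /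
        (a * ((a + 2 - b + 2 * k) * (a + b + 1 + 2 * k))) := by
  have e₁ : a * (1 + a) * risingFac (a + 2) k = risingFac a k * (a + k) * (a + k + 1) := by
    have := mul_risingFac_add_one (a + 1) k
    rw [add_assoc, one_add_one_eq_two] at this
    linear_combination a * this + (a + 1 + k) * mul_risingFac_add_one a k
  have e₂ : risingFac ((a + 2) / 2) k = risingFac (a / 2) k * (a + 2 * k) / a := by
    have := mul_risingFac_add_one (a / 2) k
    rw [show (a + 2) / 2 = a / 2 + 1 by ring, eq_div_iff ha]
    linear_combination 2 * this
  have e₃ := mul_risingFac_add_one (1 + (a - b) / 2) k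
  have e₄ := mul_risingFac_add_one ((a + b + 1) / 2) k
  have n₁ := h₁ 0
  have n₂ := h₂ 0
  have m₁ := h₁ k
  have m₂ := h₂ k
  have d₁ := risingFac_ne_zero h₁ k
  have d₂ := risingFac_ne_zero h₂ k
  have hk : (k.factorial : ℚ) ≠ 0 := by positivity
  rw [Nat.cast_zero, add_zero] at n₁ n₂
  have e₃' : risingFac (1 + (a + 2 - b) / 2) k =
      risingFac (1 + (a - b) / 2) k * (a + 2 - b + 2 * k) / (a + 2 - b) := by
    rw [show 1 + (a + 2 - b) / 2 = 1 + (a - b) / 2 + 1 by ring,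
      eq_div_iff (by contrapose! n₁; linarith)]
    linear_combination 2 * e₃
  have e₄' : risingFac ((a + 2 + b + 1) / 2) k =
      risingFac ((a + b + 1) / 2) k * (a + b + 1 + 2 * k) / (1 + a + b) := by
    rw [show (a + 2 + b + 1) / 2 = (a + b + 1) / 2 + 1 by ring,
      eq_div_iff (by contrapose! n₂; linarith)]
    linear_combination 2 * e₄
  have n₁' : a + 2 - b ≠ 0 := by contrapose! n₁; linarith
  have n₂' : 1 + a + b ≠ 0 := by contrapose! n₂; linarith
  have m₁' : a + 2 - b + 2 * k ≠ 0 := by contrapose! m₁; linarith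
  have m₂' : a + b + 1 + 2 * k ≠ 0 := by contrapose! m₂; linarith
  rw [quadTerm, quadTerm, e₂, e₃', e₄', mul_div_assoc',
    ← mul_assoc, ← mul_assoc, ← mul_assoc, e₁]
  generalize risingFac (1 + (a - b) / 2) k = D₁ at *
  generalize risingFac ((a + b + 1) / 2) k = D₂ at *
  generalize risingFac a k = A
  generalize risingFac b k = B
  generalize risingFac (1 - b) k = B'
  generalize risingFac (a / 2) k = A'
  generalize (k.factorial : ℚ) = F at *
  clear e₁ e₂ e₃ e₄ e₃' e₄' h₁ h₂ n₁ n₂ m₁ m₂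
  field_simp

theorem quadSum_add_two (a b : ℚ) (ha : a ≠ 0) (h₁ : ∀ i : ℕ, 1 + (a - b) / 2 + i ≠ 0)
    (h₂ : ∀ i : ℕ, (a + b + 1) / 2 + i ≠ 0) (K : ℕ) :
    (a + 2 - b) * (1 + a + b) * quadSum a b K - a * (1 + a) * quadSum (a + 2) b K =
      2 * ((a + 2 - b) * (1 + a + b)) / a * K ^ 2 * quadTerm a b K := by
  induction K with
  | zero => simp [quadSum]
  | succ k ih =>
    have e := quadTerm_add_two a b ha h₁ h₂ k
    have m₁' : a + 2 - b + 2 * k ≠ 0 := by have := h₁ k; contrapose! this; linarith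
    have m₂' : a + b + 1 + 2 * k ≠ 0 := by have := h₂ k; contrapose! this; linarith
    have hk : (k : ℚ) + 1 ≠ 0 := by positivity
    have hs : quadTerm a b (k + 1) =
        quadTerm a b k * ((a + k) * (b + k) * (1 - b + k) * (a + 2 * k) /
        (2 * (k + 1) ^ 2 * (a + 2 - b + 2 * k) * (a + b + 1 + 2 * k))) := by
      rw [quadTerm_succ, show 1 + (a - b) / 2 + k = (a + 2 - b + 2 * k) / 2 by ring,
        show (a + b + 1) / 2 + k = (a + b + 1 + 2 * k) / 2 by ring]
      field_simp
      ring
    simp only [quadSum, Finset.sum_range_succ] at ih ⊢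
    have key : (a + 2 - b) * (1 + a + b) * ((a + 3 * k) * quadTerm a b k)
        - (a + 2 + 3 * k) * (a * (1 + a) * quadTerm (a + 2) b k) =
        2 * ((a + 2 - b) * (1 + a + b)) / a *
          ((k + 1) ^ 2 * quadTerm a b (k + 1) - k ^ 2 * quadTerm a b k) := by
      rw [e, hs]
      generalize quadTerm a b k = t
      field_simp
      ring
    push_cast
    linear_combination ih + key

theorem quadTerm_add_two_right (a b : ℚ) (hb : b ≠ 0) (hb' : 1 + b ≠ 0)
    (h₁ : ∀ i : ℕ, (a - b) / 2 + i ≠ 0)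
    (h₂ : ∀ i : ℕ, (a + b + 1) / 2 + i ≠ 0) (k : ℕ) :
    (a - b) * ((a + b + 1 + 2 * k) * (k - 1 - b) * (k - b)) * quadTerm a (b + 2) k =
      quadTerm a b k * ((b + k) * (b + k + 1) * (a - b + 2 * k) * (a + b + 1)) := by
  have e₁ : risingFac (b + 2) k = risingFac b k * (b + k) * (b + k + 1) / (b * (1 + b)) := by
    have := mul_risingFac_add_one (b + 1) k
    rw [add_assoc, one_add_one_eq_two] at this
    field_simp
    linear_combination b * this + (b + 1 + k) * mul_risingFac_add_one b k
  have e₂ : risingFac (1 - b) k =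
      risingFac (1 - (b + 2)) k * (k - 1 - b) * (k - b) / (b * (1 + b)) := by
    have h := mul_risingFac_add_one (1 - (b + 2)) k
    have h' := mul_risingFac_add_one (1 - (b + 2) + 1) k
    rw [show 1 - (b + 2) + 1 + 1 = 1 - b by ring] at h'
    field_simp
    linear_combination (-1 - b) * h' + (k - b) * h
  have e₃ : risingFac (1 + (a - b) / 2) k = risingFac ((a - b) / 2) k * (a - b + 2 * k) / (a - b) := by
    rw [eq_div_iff (by have := h₁ 0; contrapose! this; simp [this]), add_comm 1]
    linear_combination 2 * mul_risingFac_add_one ((a - b) / 2) k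
  have e₄ : risingFac ((a + (b + 2) + 1) / 2) k =
      risingFac ((a + b + 1) / 2) k * (a + b + 1 + 2 * k) / (a + b + 1) := by
    rw [eq_div_iff (by have := h₂ 0; contrapose! this; simp [this]),
      show (a + (b + 2) + 1) / 2 = (a + b + 1) / 2 + 1 by ring]
    linear_combination 2 * mul_risingFac_add_one ((a + b + 1) / 2) k
  have n₁' : a - b ≠ 0 := by have := h₁ 0; contrapose! this; simp [this]
  have n₂' : a + b + 1 ≠ 0 := by have := h₂ 0; contrapose! this; simp [this]
  have m₁' : a - b + 2 * k ≠ 0 := by have := h₁ k; contrapose! this; linarith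
  have m₂' : a + b + 1 + 2 * k ≠ 0 := by have := h₂ k; contrapose! this; linarith
  have d₁ := risingFac_ne_zero h₁ k
  have d₂ := risingFac_ne_zero h₂ k
  have hk : (k.factorial : ℚ) ≠ 0 := by positivity
  rw [quadTerm, quadTerm, e₁, e₂, e₃, e₄, show 1 + (a - (b + 2)) / 2 = (a - b) / 2 by ring]
  field_simp

theorem quadSum_add_two_right (a b : ℚ) (hb : 0 < b) (h₁ : ∀ i : ℕ, (a - b) / 2 + i ≠ 0)
    (h₂ : ∀ i : ℕ, (a + b + 1) / 2 + i ≠ 0) (K : ℕ) :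
    (a - b) * (1 + b) * quadSum a (b + 2) K + (1 + a + b) * b * quadSum a b K =
      -2 * (1 + 2 * b) * K ^ 2 * ((a - b) * (a + b + 1 + 2 * K)) /
        ((b + K) * (b + K + 1)) * quadTerm a (b + 2) K := by
  induction K with
  | zero => simp [quadSum]
  | succ k ih =>
    have n₂ : a + b + 1 ≠ 0 := by have := h₂ 0; contrapose! this; simp [this]
    have m₁ : a - b + 2 * k ≠ 0 := by have := h₁ k; contrapose! this; linarith
    have m₂ : a + b + 1 + 2 * k ≠ 0 := by have := h₂ k; contrapose! this; linarith
    have m₃ : a + b + 1 + 2 * (k + 1) ≠ 0 := by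
      have := h₂ (k + 1); contrapose! this; push_cast; linarith
    have p₁ : b + k ≠ 0 := by positivity
    have p₂ : b + k + 1 ≠ 0 := by positivity
    have p₃ : b + (k + 1) + 1 ≠ 0 := by positivity
    have hk : (k : ℚ) + 1 ≠ 0 := by positivity
    have e : quadTerm a b k = quadTerm a (b + 2) k *
        ((a - b) * ((a + b + 1 + 2 * k) * (k - 1 - b) * (k - b)) /
          ((b + k) * (b + k + 1) * (a - b + 2 * k) * (a + b + 1))) := by
      rw [mul_div_assoc', eq_div_iff (by positivity),
        ← quadTerm_add_two_right a b hb.ne' (by positivity) h₁ h₂ k]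
      ring
    have hs : quadTerm a (b + 2) (k + 1) =
        quadTerm a (b + 2) k *
        ((a + k) * (b + k + 2) * (k - 1 - b) * (a + 2 * k) /
        (2 * (k + 1) ^ 2 * (a - b + 2 * k) * (a + b + 1 + 2 * (k + 1)))) := by
      rw [quadTerm_succ, show 1 + (a - (b + 2)) / 2 + k = (a - b + 2 * k) / 2 by ring,
        show (a + (b + 2) + 1) / 2 + k = (a + b + 1 + 2 * (k + 1)) / 2 by ring]
      generalize quadTerm a (b + 2) k = t
      field_simp
      ring
    simp only [quadSum, Finset.sum_range_succ] at ih ⊢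
    have key : (a - b) * (1 + b) * ((a + 3 * k) * quadTerm a (b + 2) k)
        + (1 + a + b) * b * ((a + 3 * k) * quadTerm a b k) =
        -2 * (1 + 2 * b) * (k + 1) ^ 2 * ((a - b) * (a + b + 1 + 2 * (k + 1))) /
            ((b + (k + 1)) * (b + (k + 1) + 1)) * quadTerm a (b + 2) (k + 1)
          - -2 * (1 + 2 * b) * k ^ 2 * ((a - b) * (a + b + 1 + 2 * k)) /
            ((b + k) * (b + k + 1)) * quadTerm a (b + 2) k := by
      have e' : (1 + a + b) * b * ((a + 3 * k) * quadTerm a b k) =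
          b * (a + 3 * k) * (a - b) * (a + b + 1 + 2 * k) * (k - 1 - b) * (k - b) *
            quadTerm a (b + 2) k / ((b + k) * (b + k + 1) * (a - b + 2 * k)) := by
        rw [e]
        generalize quadTerm a (b + 2) k = t
        field_simp
        ring
      have hs' : -2 * (1 + 2 * b) * (k + 1) ^ 2 * ((a - b) * (a + b + 1 + 2 * (k + 1))) /
            ((b + (k + 1)) * (b + (k + 1) + 1)) * quadTerm a (b + 2) (k + 1) =
          -(1 + 2 * b) * (a - b) * (a + k) * (k - 1 - b) * (a + 2 * k) * quadTerm a (b + 2) k /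
            ((b + k + 1) * (a - b + 2 * k)) := by
        rw [hs, show b + ((k : ℚ) + 1) + 1 = b + k + 2 by ring, ← add_assoc b (k : ℚ) 1]
        rw [show b + ((k : ℚ) + 1) + 1 = b + k + 2 by ring] at p₃
        generalize quadTerm a (b + 2) k = t
        field_simp
      rw [e', hs']
      generalize quadTerm a (b + 2) k = t
      rw [add_div' _ _ _ (by positivity), div_mul_eq_mul_div,
        div_sub_div _ _ (by positivity) (by positivity),
        div_eq_div_iff (by positivity) (by positivity)]
      ring
    push_cast
    linear_combination ih + key

theorem quadSum_neg_eq_zero (b : ℚ) (hb : ∀ m : ℤ, b ≠ m) (n : ℕ) (hn : n ≠ 0)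
    {K : ℕ} (hK : n < K) :
    quadSum (-n) b K = 0 := by
  have hz : quadSum 0 b K = 0 := Finset.sum_eq_zero fun k _ => by
    rcases eq_or_ne k 0 with rfl | hk
    · simp
    · have : risingFac 0 k = 0 := by
        simpa using risingFac_neg_eq_zero (n := 0) (Nat.pos_of_ne_zero hk)
      simp [quadTerm, this]
  have step (n : ℕ) (hn : n ≠ 0) (hK : n < K) :
      quadSum (-n) b K = 0 ∨ -(n : ℚ) * (1 + -n) * quadSum (-n + 2) b K ≠ 0 := by
    have hn' : -(n : ℚ) ≠ 0 := by simpa using hn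
    have h := quadSum_add_two (-n) b hn'
      (fun i h => hb (2 - n + 2 * i) (by push_cast; linarith))
      (fun i h => hb (n - 1 - 2 * i) (by push_cast; linarith)) K
    simp only [quadTerm, risingFac_neg_eq_zero hK, zero_mul, zero_div, mul_zero] at h
    by_contra! hc
    rw [hc.2, sub_zero] at h
    refine mul_ne_zero (mul_ne_zero ?_ ?_) hc.1 h
    · exact fun h => hb (2 - n) (by push_cast; linarith)
    · exact fun h => hb (n - 1) (by push_cast; linarith)
  induction n using Nat.twoStepInduction with
  | zero => exact absurd rfl hn
  | one =>
    have h := step 1 one_ne_zero hK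
    simpa using h
  | more n ih _ =>
    have h := step (n + 2) hn hK
    rcases eq_or_ne n 0 with rfl | hn0
    · simpa [hz] using h
    · rw [show (-((n + 2 : ℕ) : ℚ)) + 2 = -n by push_cast; ring, ih hn0 (by omega)] at h
      simpa using h

theorem quadSum_two (a : ℚ) (_ : a ≠ 0) (h₃ : a + 3 ≠ 0) {K : ℕ} (hK : 2 ≤ K) :
    quadSum a 2 K = 0 := by
  obtain ⟨K, rfl⟩ := Nat.exists_eq_add_of_le' hK
  rw [quadSum, Finset.sum_range_succ', Finset.sum_range_succ', Finset.sum_eq_zero]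
  · simp [quadTerm, risingFac]
    have : (a + 2 + 1) ≠ 0 := by contrapose! h₃; linarith
    rw [show 1 + (a - 2) / 2 = a / 2 by ring]
    field_simp
    ring
  · intro k _
    have : risingFac (1 - 2) (k + 2) = 0 := by
      simpa [show (1 - 2 : ℚ) = -1 by norm_num] using
        risingFac_neg_eq_zero (n := 1) (k := k + 2) (by omega)
    simp [quadTerm, add_assoc, this]

theorem quadSum_even_eq_zero (a : ℚ) (ha : ∀ m : ℤ, a ≠ m) (m : ℕ)
    {K : ℕ} (hK : 2 * m + 2 ≤ K) :
    quadSum a (2 * m + 2) K = 0 := by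
  induction m with
  | zero =>
    simpa using quadSum_two a (by simpa using ha 0)
      (fun h => ha (-3) (by push_cast; linarith)) hK
  | succ m ih =>
    have h := quadSum_add_two_right a (2 * m + 2) (by positivity)
      (fun i h => ha (2 * m + 2 - 2 * i) (by push_cast; linarith))
      (fun i h => ha (-(2 * m + 3) - 2 * i) (by push_cast; linarith)) K
    have h0 : risingFac (1 - (2 * m + 2 + 2)) K = 0 := by
      have := risingFac_neg_eq_zero (n := 2 * m + 3) (k := K) (by omega)
      rwa [show (-((2 * m + 3 : ℕ) : ℚ)) = 1 - (2 * m + 2 + 2) by push_cast; ring] at this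
    rw [ih (by omega)] at h
    simp only [quadTerm, h0, mul_zero, zero_mul, zero_div, add_zero] at h
    have hne : (a - (2 * m + 2)) * (1 + (2 * m + 2)) ≠ 0 :=
      mul_ne_zero (fun h => ha (2 * m + 2) (by push_cast; linarith)) (by positivity)
    have := (mul_eq_zero.mp h).resolve_left hne
    rwa [show 2 * ((m + 1 : ℕ) : ℚ) + 2 = 2 * m + 2 + 2 by push_cast; ring]

theorem quadSum_neg_two_mul_eq_zero (b : ℚ) (hb : ∀ m : ℤ, b ≠ m) (n : ℕ) (hn : n ≠ 0) {K : ℕ}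
    (hK : n < K) : quadSum (-(2 * n)) b K = 0 := by
  have h := quadSum_neg_eq_zero b hb (2 * n) (by omega) (K := K + 2 * n) (by omega)
  push_cast at h
  rw [← h]
  refine Finset.sum_subset (Finset.range_mono (by omega)) fun k _ hk => ?_
  have hk : K ≤ k := by simpa using hk
  have : risingFac (-(2 * n) / 2) k = 0 := by
    rw [show -(2 * n : ℚ) / 2 = -n by ring]
    exact risingFac_neg_eq_zero (by omega)
  simp [quadTerm, this]

open Polynomial in
theorem prod_X_sub_C_dvd_of_isRoot {P : ℤ[X]} {s : Finset ℤ} (h : ∀ r ∈ s, P.IsRoot r) :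
    ∏ r ∈ s, (X - C r) ∣ P := by
  rcases eq_or_ne P 0 with rfl | hP
  · exact dvd_zero _
  · refine (Multiset.prod_X_sub_C_dvd_iff_le_roots hP s.val).mpr ?_
    rw [Multiset.le_iff_subset s.nodup]
    exact fun r hr => (mem_roots hP).mpr (h r hr)

/-- The numerator of the ratio of consecutive terms `quadTerm` on the line
`a = (1 + u) / 2`, `b = (2 + u) / 4`. -/
def lineNum (u : ℚ) (i : ℕ) : ℚ :=
  (2 * i + 1 + u) * (4 * i + 2 + u) * (4 * i + 2 - u) * (4 * i + 1 + u)

/-- The denominator of the ratio of consecutive terms `quadTerm` on the line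
`a = (1 + u) / 2`, `b = (2 + u) / 4`. -/
def lineDen (u : ℚ) (i : ℕ) : ℚ := 8 * (i + 1) ^ 2 * (8 * i + 8 + u) * (8 * i + 8 + 3 * u)

theorem quadTerm_line (u : ℚ) (k : ℕ) :
    quadTerm ((1 + u) / 2) ((2 + u) / 4) k =
      (∏ i ∈ Finset.range k, lineNum u i) / ∏ i ∈ Finset.range k, lineDen u i := by
  induction k with
  | zero => simp [quadTerm, risingFac]
  | succ k ih =>
    rw [quadTerm_succ, Finset.prod_range_succ, Finset.prod_range_succ, ih,
      mul_div_mul_comm _ (lineNum u k),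
      ← mul_div_mul_left (lineNum u k) (lineDen u k) (show (1 / 128 : ℚ) ≠ 0 by norm_num)]
    congr 2 <;> simp only [lineNum, lineDen] <;> ring

open Polynomial in
/-- The sum `2 * quadSum` along the line `a = (1 + u) / 2`, `b = (2 + u) / 4`,
cleared of denominators. -/
noncomputable def linePoly (n : ℕ) : ℤ[X] :=
  ∑ k ∈ Finset.range (n + 1), (6 * (k : ℤ[X]) + 1 + X) *
    (∏ i ∈ Finset.range k,
      (2 * (i : ℤ[X]) + 1 + X) * (4 * (i : ℤ[X]) + 2 + X) * (4 * (i : ℤ[X]) + 2 - X) *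
        (4 * (i : ℤ[X]) + 1 + X)) *
    ∏ i ∈ Finset.Ico k n,
      8 * ((i : ℤ[X]) + 1) ^ 2 * (8 * (i : ℤ[X]) + 8 + X) * (8 * (i : ℤ[X]) + 8 + 3 * X)

theorem linePoly_eval (n : ℕ) (u : ℤ) (hu : ∀ i < n, lineDen u i ≠ 0) :
    (((linePoly n).eval u : ℤ) : ℚ) =
      (∏ i ∈ Finset.range n, lineDen u i) *
        (2 * quadSum ((1 + u) / 2) ((2 + u) / 4) (n + 1)) := by
  simp only [linePoly, quadSum, Polynomial.eval_finsetSum, Polynomial.eval_mul,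
    Polynomial.eval_prod, Polynomial.eval_add, Polynomial.eval_sub, Polynomial.eval_X,
    Polynomial.eval_natCast, Polynomial.eval_one, Polynomial.eval_ofNat, Polynomial.eval_pow,
    Finset.mul_sum]
  push_cast
  refine Finset.sum_congr rfl fun k hk => ?_
  have hkn : k ≤ n := Nat.lt_succ_iff.mp (Finset.mem_range.mp hk)
  have h0 : ∏ i ∈ Finset.range k, lineDen u i ≠ 0 :=
    Finset.prod_ne_zero_iff.mpr fun i hi => hu i ((Finset.mem_range.mp hi).trans_le hkn)
  rw [quadTerm_line, ← Finset.prod_range_mul_prod_Ico _ hkn]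
  change _ * (∏ i ∈ Finset.range k, lineNum u i) * ∏ i ∈ Finset.Ico k n, lineDen u i = _
  field_simp
  ring

theorem lineDen_ne_zero {p : ℕ} (hp : p % 4 = 3) {u : ℤ}
    (hu : u = -p ∨ u = -3 * p ∨ u = 2 * p ∨ u = -2 * p) (i : ℕ) : lineDen u i ≠ 0 := by
  have h : lineDen u i =
      ((8 * (i + 1) ^ 2 * (8 * i + 8 + u) * (8 * i + 8 + 3 * u) : ℤ) : ℚ) := by
    rw [lineDen]; push_cast; rfl
  rw [h, Int.cast_ne_zero]
  refine mul_ne_zero (mul_ne_zero (by positivity) ?_) ?_ <;> omega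

theorem linePoly_isRoot {p : ℕ} (hp : p % 4 = 3) {u : ℤ}
    (hu : u = -p ∨ u = -3 * p ∨ u = 2 * p ∨ u = -2 * p) : (linePoly (p - 1)).IsRoot u := by
  obtain ⟨m, rfl⟩ : ∃ m, p = 4 * m + 3 := ⟨p / 4, by omega⟩
  have hint (x : ℚ) (c : ℤ) (hc : 4 * x = c) (hc' : c % 4 ≠ 0) (z : ℤ) : x ≠ z := by
    rintro rfl
    have : 4 * z = c := by exact_mod_cast hc
    omega
  have h : quadSum ((1 + u) / 2) ((2 + u) / 4) (4 * m + 3) = 0 := by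
    rcases hu with rfl | rfl | rfl | rfl
    · have := quadSum_neg_eq_zero ((2 + (-(4 * m + 3 : ℕ) : ℤ)) / 4)
        (hint _ (2 - (4 * m + 3)) (by push_cast; ring) (by omega)) (2 * m + 1) (by omega)
        (K := 4 * m + 3) (by omega)
      convert this using 2
      push_cast
      ring
    · have := quadSum_neg_two_mul_eq_zero ((2 + (-3 * (4 * m + 3 : ℕ) : ℤ)) / 4)
        (hint _ (2 - 3 * (4 * m + 3)) (by push_cast; ring) (by omega)) (3 * m + 2) (by omega)
        (K := 4 * m + 3) (by omega)
      convert this using 2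
      push_cast
      ring
    · have := quadSum_even_eq_zero ((1 + (2 * (4 * m + 3 : ℕ) : ℤ)) / 2)
        (hint _ (2 + 4 * (4 * m + 3)) (by push_cast; ring) (by omega)) m
        (K := 4 * m + 3) (by omega)
      convert this using 2
      push_cast
      ring
    · have := quadSum_even_eq_zero ((1 + (-2 * (4 * m + 3 : ℕ) : ℤ)) / 2)
        (hint _ (2 - 4 * (4 * m + 3)) (by push_cast; ring) (by omega)) m
        (K := 4 * m + 3) (by omega)
      rw [← this]
      refine Finset.sum_congr rfl fun k _ => ?_
      rw [← quadTerm_one_sub _ (2 * (m : ℚ) + 2)]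
      congr 2
      push_cast
      ring
  rw [Polynomial.IsRoot, ← Int.cast_eq_zero (α := ℚ),
    linePoly_eval _ _ fun i _ => lineDen_ne_zero hp hu i]
  simp [h]

theorem pow_four_dvd_linePoly_eval_zero {p : ℕ} (hp : p % 4 = 3) :
    (p : ℤ) ^ 4 ∣ (linePoly (p - 1)).eval 0 := by
  have h : ∀ r ∈ ({-(p : ℤ), -3 * (p : ℤ), 2 * (p : ℤ), -2 * (p : ℤ)} : Finset ℤ),
      (linePoly (p - 1)).IsRoot r :=
    fun r hr => linePoly_isRoot hp (by simpa using hr)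
  have h := Polynomial.eval_dvd (x := 0) (prod_X_sub_C_dvd_of_isRoot h)
  refine dvd_trans ⟨-12, ?_⟩ h
  rw [Finset.prod_insert (by simp; omega), Finset.prod_insert (by simp; omega),
    Finset.prod_insert (by simp; omega), Finset.prod_singleton]
  simp
  ring

theorem stmt_0 (p : ℕ) [Fact p.Prime] (hodd : Odd p) (hp4 : p % 4 = 3) :
    ‖((∑ k ∈ Finset.range p,
        (6 * k + 1 : ℚ) * risingFac (1/2) k ^ 3 * risingFac (1/4) k /
          ((k.factorial : ℚ) ^ 4 * 4 ^ k) : ℚ) : ℚ_[p])‖ ≤ (p : ℝ) ^ (-4 : ℤ) := by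
  have hp : p.Prime := Fact.out
  have hp1 : p - 1 + 1 = p := by omega
  have hsum : ∑ k ∈ Finset.range p, (6 * k + 1 : ℚ) * risingFac (1/2) k ^ 3 * risingFac (1/4) k /
      ((k.factorial : ℚ) ^ 4 * 4 ^ k) = 2 * quadSum ((1 + (0 : ℤ)) / 2) ((2 + (0 : ℤ)) / 4) p := by
    rw [quadSum, Finset.mul_sum]
    refine Finset.sum_congr rfl fun k _ => ?_
    have h1 : risingFac 1 k = k.factorial := by
      rw [risingFac, ← Finset.prod_range_add_one_eq_factorial]
      push_cast
      exact Finset.prod_congr rfl fun i _ => add_comm _ _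
    norm_num [quadTerm, h1]
    ring
  set D : ℤ := ∏ i ∈ Finset.range (p - 1), 8 * (i + 1) ^ 2 * (8 * i + 8) * (8 * i + 8) with hD
  have hden : ((D : ℤ) : ℚ) = ∏ i ∈ Finset.range (p - 1), lineDen (0 : ℤ) i := by
    rw [hD]
    push_cast
    simp [lineDen]
  have hE := linePoly_eval (p - 1) 0 fun i _ => by
    rw [lineDen]; push_cast; positivity
  rw [hp1, ← hden, ← hsum] at hE
  have hpD : ¬ (p : ℤ) ∣ D := by
    have hpZ : Prime (p : ℤ) := Nat.prime_iff_prime_int.mp hp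
    rw [hD, Prime.dvd_finsetProd_iff hpZ]
    rintro ⟨i, hi, h⟩
    have hi := Finset.mem_range.mp hi
    have h2 : ¬ (p : ℤ) ∣ 2 := fun h => by
      have := Int.le_of_dvd (by norm_num) h
      omega
    have h3 : ¬ (p : ℤ) ∣ i + 1 := fun h => by
      have := Int.le_of_dvd (by positivity) h
      omega
    rw [show (8 * (i + 1) ^ 2 * (8 * i + 8) * (8 * i + 8) : ℤ) = 2 ^ 9 * (i + 1) ^ 4 by ring] at h
    exact (hpZ.dvd_or_dvd h).elim (fun h => h2 (hpZ.dvd_of_dvd_pow h))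
      (fun h => h3 (hpZ.dvd_of_dvd_pow h))
  have hnD : ‖((D : ℤ) : ℚ_[p])‖ = 1 := by
    refine le_antisymm (Padic.norm_int_le_one D) (not_lt.mp fun h => hpD ?_)
    exact Padic.norm_intCast_lt_one_iff.mp h
  have hnP := (Padic.norm_int_le_pow_iff_dvd _ 4).mpr
    (show ((p ^ 4 : ℕ) : ℤ) ∣ _ by exact_mod_cast pow_four_dvd_linePoly_eval_zero hp4)
  have hE' := congrArg (fun q : ℚ => ‖(q : ℚ_[p])‖) hE
  simp only [Rat.cast_intCast, Rat.cast_mul, norm_mul, hnD, one_mul] at hE'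
  rw [← hE']
  exact_mod_cast hnP
end

section
/- Let p be an odd prime with p ≡ 3 (mod 4). Then the sum over k from 0 to p-1 of (6k+1)·(1/2)_k^3·(1/4)_k^2 / k!^5 is congruent to 0 modulo p^3. -/
/-- The ratio of consecutive terms of the two-parameter deformation of the hypergeometric
series, whose undeformed case is `x = y = 0`. -/
def termRatio (x y : ℚ) (j : ℕ) : ℚ :=
  (1 / 2 + j) * (((1 / 2 + j) ^ 2 - x ^ 2) / ((j + 1) ^ 2 - 1 / 4 * x ^ 2)) *
    (((1 / 4 + j) ^ 2 - y ^ 2) / ((j + 1) ^ 2 - 4 * y ^ 2)) / (j + 1)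

/-- The partial sums of the deformed series. -/
def deformedSum (x y : ℚ) (N : ℕ) : ℚ :=
  ∑ k ∈ Finset.range N, (6 * k + 1 : ℚ) * ∏ j ∈ Finset.range k, termRatio x y j

theorem sum_eq_of_gosper {s a b q f : ℕ → ℚ} (hb : b 0 = 0)
    (hs : ∀ k, s (k + 1) * b (k + 1) = s k * a k)
    (hf : ∀ k, f k = s k * (a k * q (k + 1) - b k * q k)) (N : ℕ) :
    ∑ k ∈ Finset.range N, f k = s N * b N * q N := by
  induction N with
  | zero => simp [hb]
  | succ n ih => rw [Finset.sum_range_succ, ih, hf, hs]; ring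

theorem prod_mul_eq_of_ratio {u v L : ℕ → ℚ} (h : ∀ k, u k * L k = v k * L (k + 1)) (k : ℕ) :
    (∏ j ∈ Finset.range k, u j) * L 0 = (∏ j ∈ Finset.range k, v j) * L k := by
  induction k with
  | zero => simp
  | succ n ih =>
    rw [Finset.prod_range_succ, Finset.prod_range_succ]
    linear_combination u n * ih + (∏ j ∈ Finset.range n, v j) * h n

/-- If both terms are rational multiples of a common product of ratios `a k / b (k + 1)` that
vanishes before `N`, a Gosper certificate relates the two sums. -/
theorem sum_eq_mul_sum_of_certificate {u v L M a b q w : ℕ → ℚ} {r : ℚ} {N m : ℕ} (hb : b 0 = 0)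
    (hb' : ∀ k, b (k + 1) ≠ 0) (hL0 : L 0 ≠ 0) (hM0 : M 0 ≠ 0)
    (hu : ∀ k, u k * L k = a k / b (k + 1) * L (k + 1))
    (hv : ∀ k, v k * M k = a k / b (k + 1) * M (k + 1))
    (hcert : ∀ k, w k * M k / M 0 - r * (w k * L k / L 0) = a k * q (k + 1) - b k * q k)
    (hm : m < N) (ha : a m = 0) :
    ∑ k ∈ Finset.range N, w k * ∏ j ∈ Finset.range k, v j =
      r * ∑ k ∈ Finset.range N, w k * ∏ j ∈ Finset.range k, u j := by
  set s : ℕ → ℚ := fun k ↦ ∏ j ∈ Finset.range k, a j / b (j + 1) with hs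
  have key := sum_eq_of_gosper (s := s) (a := a) (b := b) (q := q)
    (f := fun k ↦ w k * (∏ j ∈ Finset.range k, v j) -
      r * (w k * ∏ j ∈ Finset.range k, u j)) hb
    (fun k ↦ by
      simp only [hs, Finset.prod_range_succ]
      field_simp [hb' k])
    (fun k ↦ by
      have h1 := eq_div_of_mul_eq hL0 (prod_mul_eq_of_ratio hu k)
      have h2 := eq_div_of_mul_eq hM0 (prod_mul_eq_of_ratio hv k)
      rw [← hcert, h1, h2]
      ring) N
  have hsN : s N = 0 := Finset.prod_eq_zero (Finset.mem_range.2 hm) (by simp [ha])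
  rw [hsN, zero_mul, zero_mul, Finset.sum_sub_distrib, ← Finset.mul_sum] at key
  linarith

theorem int_cast_ne_two_mul_add_half (k : ℤ) (m : ℕ) : (k : ℚ) ≠ 2 * m + 1 / 2 := by
  intro h
  have h' : (2 * k : ℚ) = 4 * m + 1 := by linarith
  norm_cast at h'
  omega

theorem deformedSum_add_one {x y : ℚ} {N m : ℕ} (hm : m + 1 < N) (hy : y = m + 1 / 4)
    (hx : ∀ k : ℕ, (k + 1 : ℚ) ^ 2 - 1 / 4 * x ^ 2 ≠ 0) :
    deformedSum x (y + 1) N =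
      (y + 1) * ((2 * y + 1 / 2) ^ 2 - x ^ 2) / (y * ((2 * y + 3 / 2) ^ 2 - x ^ 2)) *
        deformedSum x y N := by
  have hy0 : 0 < y := by rw [hy]; positivity
  have hyi (k : ℤ) : (k : ℚ) - 2 * y ≠ 0 := by
    have := int_cast_ne_two_mul_add_half k m
    rw [sub_ne_zero]
    convert this using 1
    rw [hy]; ring
  have h1 (k : ℕ) : (k + 1 : ℚ) - 2 * y ≠ 0 := by simpa using hyi (k + 1)
  have h2 (k : ℕ) : (k : ℚ) - 1 - 2 * y ≠ 0 := by simpa using hyi (k - 1)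
  have hD : (2 * y + 3 / 2) ^ 2 - x ^ 2 ≠ 0 := by
    have := hx m
    contrapose! this
    rw [hy] at this
    linarith
  have hk (k : ℕ) : (0 : ℚ) ≤ k := k.cast_nonneg
  have e1 (k : ℕ) : (k + 1 : ℚ) ^ 2 - 4 * y ^ 2 = (k + 1 - 2 * y) * (k + 1 + 2 * y) := by ring
  have e2 (k : ℕ) : (k + 1 : ℚ) ^ 2 - 4 * (y + 1) ^ 2 =
    (k - 1 - 2 * y) * (k + 3 + 2 * y) := by ring
  have p1 (k : ℕ) : (k + 1 : ℚ) + 2 * y ≠ 0 := by have := hk k; positivity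
  have p3 (k : ℕ) : (k + 3 : ℚ) + 2 * y ≠ 0 := by have := hk k; positivity
  refine sum_eq_mul_sum_of_certificate (m := m + 1)
    (a := fun k ↦ (k + 1 / 2) * ((k + 1 / 2) ^ 2 - x ^ 2) * (k + 1 / 4 + y) * (k - 3 / 4 - y))
    (b := fun k ↦ k * (k ^ 2 - 1 / 4 * x ^ 2) * (k - 2 * y) * (k + 2 + 2 * y))
    (L := fun k ↦ (k - 3 / 4 - y) * (k + 1 + 2 * y) * (k + 2 + 2 * y))
    (M := fun k ↦ (k + 1 / 4 + y) * (k - 1 - 2 * y) * (k - 2 * y))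
    (q := fun k ↦ -32 * (1 - 2 * k) /
      ((1 + 4 * y) * (3 + 4 * y) * (y * ((2 * y + 3 / 2) ^ 2 - x ^ 2))))
    (by simp) (fun k ↦ ?_) ?_ ?_ (fun k ↦ ?_) (fun k ↦ ?_) (fun k ↦ ?_) hm ?_
  · push_cast
    have := hx k
    have := h1 k
    have := hk k
    have : (k + 1 + 2 + 2 * y : ℚ) ≠ 0 := by positivity
    positivity
  · have h34 : (0 : ℚ) - 3 / 4 - y ≠ 0 := by linarith
    simp only [Nat.cast_zero]
    positivity
  · have := h2 0
    have := hyi 0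
    simp only [Nat.cast_zero, Int.cast_zero] at *
    positivity
  · simp only [termRatio, e1]
    push_cast
    have := hx k
    have := h1 k
    have := p1 k
    have := p3 k
    have : (k + 1 + 2 + 2 * y : ℚ) ≠ 0 := by convert p3 k using 1; ring
    field_simp
    ring
  · simp only [termRatio, e2]
    push_cast
    have := hx k
    have := h1 k
    have := h2 k
    have := p1 k
    have := p3 k
    have : (k + 1 + 2 + 2 * y : ℚ) ≠ 0 := by convert p3 k using 1; ring
    field_simp
    ring
  · have h12' : 1 + 2 * y ≠ 0 := by linarith
    have h14 : 1 + 4 * y ≠ 0 := by linarith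
    have h34' : 3 + 4 * y ≠ 0 := by linarith
    have hL : ((0 : ℚ) - 3 / 4 - y) * (0 + 1 + 2 * y) * (0 + 2 + 2 * y) =
      -((3 + 4 * y) * (1 + 2 * y) * (1 + y)) / 2 := by ring
    have hM : ((0 : ℚ) + 1 / 4 + y) * (0 - 1 - 2 * y) * (0 - 2 * y) =
      (1 + 4 * y) * (1 + 2 * y) * y / 2 := by ring
    have h1y : 1 + y ≠ 0 := by linarith
    obtain ⟨D, hDx⟩ : ∃ D, x ^ 2 = (2 * y + 3 / 2) ^ 2 - D :=
      ⟨(2 * y + 3 / 2) ^ 2 - x ^ 2, by ring⟩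
    push_cast
    rw [hL, hM]
    rw [hDx, sub_sub_cancel] at hD
    simp only [hDx, sub_sub_cancel]
    field_simp
    ring
  · push_cast
    rw [hy]
    ring

theorem deformedSum_add_two {x : ℚ} {N n : ℕ} (hn : n + 2 < N) (hx : x = n + 1 / 2) :
    deformedSum (x + 2) 0 N =
      (x + 2) * (2 * x + 1) ^ 2 / (x * (2 * x + 3) ^ 2) * deformedSum x 0 N := by
  have hx0 : 0 < x := by rw [hx]; positivity
  have hxi (k : ℤ) : 2 * (k : ℚ) - x ≠ 0 := by
    intro h
    have h' : (4 * k : ℚ) = 2 * n + 1 := by linarith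
    norm_cast at h'
    omega
  have h1 (k : ℕ) : 2 * (k + 1 : ℚ) - x ≠ 0 := by simpa using hxi (k + 1)
  have h2 (k : ℕ) : 2 * (k : ℚ) - x ≠ 0 := by simpa using hxi k
  have hk (k : ℕ) : (0 : ℚ) ≤ k := k.cast_nonneg
  have e1 (k : ℕ) : (k + 1 : ℚ) ^ 2 - 1 / 4 * x ^ 2 =
    (2 * (k + 1) - x) * (2 * (k + 1) + x) / 4 := by ring
  have e2 (k : ℕ) : (k + 1 : ℚ) ^ 2 - 1 / 4 * (x + 2) ^ 2 =
    (2 * k - x) * (2 * (k + 2) + x) / 4 := by ring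
  have p1 (k : ℕ) : 2 * (k + 1 : ℚ) + x ≠ 0 := by have := hk k; positivity
  have p2 (k : ℕ) : 2 * (k + 2 : ℚ) + x ≠ 0 := by have := hk k; positivity
  refine sum_eq_mul_sum_of_certificate (m := n + 2)
    (a := fun k ↦ (k + 1 / 2) * (k + 1 / 2 + x) * (k - 3 / 2 - x) * (k + 1 / 4) ^ 2)
    (b := fun k ↦ k * (2 * k - x) * (2 * (k + 1) + x) / 4 * k ^ 2)
    (L := fun k ↦ (k - 3 / 2 - x) * (k - 1 / 2 - x) * (2 * (k + 1) + x))
    (M := fun k ↦ (k + 1 / 2 + x) * (k + 3 / 2 + x) * (2 * k - x))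
    (q := fun k ↦ -256 * (1 - 2 * k) / (x * (2 * x + 3) ^ 3 * (2 * x + 1)))
    (by simp) (fun k ↦ ?_) ?_ ?_ (fun k ↦ ?_) (fun k ↦ ?_) (fun k ↦ ?_) hn ?_
  · push_cast
    have := h1 k
    have := hk k
    positivity
  · have h3 : (0 : ℚ) - 3 / 2 - x ≠ 0 := by linarith
    have h4 : (0 : ℚ) - 1 / 2 - x ≠ 0 := by linarith
    simp only [Nat.cast_zero]
    positivity
  · have := h2 0
    simp only [Nat.cast_zero] at *
    positivity
  · simp only [termRatio, e1]
    push_cast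
    have := h1 k
    have := p1 k
    have := p2 k
    have : 2 * (k + 1 + 1 : ℚ) + x ≠ 0 := by convert p2 k using 1; ring
    field_simp
    ring
  · simp only [termRatio, e2]
    push_cast
    have := h1 k
    have := h2 k
    have := p2 k
    have : 2 * (k + 1 + 1 : ℚ) + x ≠ 0 := by convert p2 k using 1; ring
    field_simp
    ring
  · have h3 : 2 * x + 3 ≠ 0 := by linarith
    have h4 : 2 * x + 1 ≠ 0 := by linarith
    have h5 : x + 2 ≠ 0 := by linarith
    have hL : ((0 : ℚ) - 3 / 2 - x) * (0 - 1 / 2 - x) * (2 * (0 + 1) + x) =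
      (2 * x + 3) * (2 * x + 1) * (x + 2) / 4 := by ring
    have hM : ((0 : ℚ) + 1 / 2 + x) * (0 + 3 / 2 + x) * (2 * 0 - x) =
      -((2 * x + 1) * (2 * x + 3) * x) / 4 := by ring
    push_cast
    rw [hL, hM]
    field_simp
    ring
  · push_cast
    rw [hx]
    ring

theorem deformedSum_eq_prod {x : ℚ} {N m : ℕ} (hm : m < N)
    (hx : ∀ k : ℕ, (k + 1 : ℚ) ^ 2 - 1 / 4 * x ^ 2 ≠ 0) :
    deformedSum x (m + 1 / 4) N =
      (4 * m + 1) * ∏ j ∈ Finset.range m, ((2 * j + 1) ^ 2 - x ^ 2) / ((2 * j + 2) ^ 2 - x ^ 2) := by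
  induction m with
  | zero =>
    rw [deformedSum, ← Finset.sum_subset (Finset.range_subset_range.2 (Nat.succ_le_of_lt hm))]
    · simp
    · intro k _ hk
      have : 0 < k := by simpa [Nat.pos_iff_ne_zero] using hk
      rw [Finset.prod_eq_zero (Finset.mem_range.2 this), mul_zero]
      simp [termRatio]
  | succ m ih =>
    have hD : (2 * m + 2 : ℚ) ^ 2 - x ^ 2 ≠ 0 := by
      have := hx m
      contrapose! this
      linarith
    have h4 : (4 * m + 1 : ℚ) ≠ 0 := by positivity
    have h := deformedSum_add_one hm rfl hx
    rw [ih (by omega)] at h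
    have e : ((m + 1 : ℕ) : ℚ) + 1 / 4 = m + 1 / 4 + 1 := by push_cast; ring
    rw [e, h, Finset.prod_range_succ]
    have e1 : (2 * (m + 1 / 4) + 1 / 2 : ℚ) = 2 * m + 1 := by ring
    have e2 : (2 * (m + 1 / 4) + 3 / 2 : ℚ) = 2 * m + 2 := by ring
    have e3 : (m + 1 / 4 : ℚ) = (4 * m + 1) / 4 := by ring
    rw [e1, e2, e3]
    generalize ∏ j ∈ Finset.range m, ((2 * j + 1 : ℚ) ^ 2 - x ^ 2) / ((2 * j + 2) ^ 2 - x ^ 2) = P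
    push_cast
    field_simp
    ring

theorem deformedSum_eq_zero {N t : ℕ} (ht : 2 * t + 1 < N) :
    deformedSum (2 * t + 3 / 2) 0 N = 0 := by
  induction t with
  | zero =>
    rw [deformedSum, ← Finset.sum_subset (Finset.range_subset_range.2 (Nat.succ_le_of_lt ht))]
    · norm_num [Finset.sum_range_succ, termRatio]
    · intro k _ hk
      have : 1 < k := by simpa using hk
      rw [Finset.prod_eq_zero (Finset.mem_range.2 this), mul_zero]
      norm_num [termRatio]
  | succ t ih =>
    have h := deformedSum_add_two (x := 2 * t + 3 / 2) (n := 2 * t + 1) ht (by push_cast; ring)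
    rw [ih (by omega), mul_zero] at h
    rw [← h]
    congr 1
    push_cast
    ring

theorem risingFac_term_eq_prod_termRatio (k : ℕ) :
    risingFac (1 / 2) k ^ 3 * risingFac (1 / 4) k ^ 2 / (k.factorial : ℚ) ^ 5 =
      ∏ j ∈ Finset.range k, termRatio 0 0 j := by
  induction k with
  | zero => simp [risingFac]
  | succ k ih =>
    rw [Finset.prod_range_succ, ← ih, Nat.factorial_succ]
    simp only [risingFac, Finset.prod_range_succ, termRatio]
    have : (k.factorial : ℚ) ≠ 0 := by positivity
    push_cast
    field_simp
    ring

section PadicNorm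

variable {p : ℕ} [Fact p.Prime] {ι : Type*}

theorem padicNorm_sub_le {a b ε : ℚ} (ha : padicNorm p a ≤ ε) (hb : padicNorm p b ≤ ε) :
    padicNorm p (a - b) ≤ ε :=
  padicNorm.sub.trans (max_le ha hb)

theorem padicNorm_mul_le {a b α β : ℚ} (ha : padicNorm p a ≤ α) (hb : padicNorm p b ≤ β) :
    padicNorm p (a * b) ≤ α * β := by
  rw [padicNorm.mul]
  exact mul_le_mul ha hb (padicNorm.nonneg _) ((padicNorm.nonneg _).trans ha)

theorem padicNorm_prod_le_one {s : Finset ι} {u : ι → ℚ} (hu : ∀ i ∈ s, padicNorm p (u i) ≤ 1) :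
    padicNorm p (∏ i ∈ s, u i) ≤ 1 :=
  Finset.prod_induction u (padicNorm p · ≤ 1)
    (fun a b ha hb ↦ by simpa using padicNorm_mul_le ha hb) (by simp) hu

theorem padicNorm_prod_sub_prod_le {u v : ℕ → ℚ} {ε : ℚ} (hε : 0 ≤ ε) {k : ℕ}
    (hu : ∀ j < k, padicNorm p (u j) ≤ 1) (hv : ∀ j < k, padicNorm p (v j) ≤ 1)
    (huv : ∀ j < k, padicNorm p (u j - v j) ≤ ε) :
    padicNorm p (∏ j ∈ Finset.range k, u j - ∏ j ∈ Finset.range k, v j) ≤ ε := by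
  induction k with
  | zero => simpa
  | succ k ih =>
    have e : ∏ j ∈ Finset.range (k + 1), u j - ∏ j ∈ Finset.range (k + 1), v j =
        (∏ j ∈ Finset.range k, u j - ∏ j ∈ Finset.range k, v j) * u k -
          (∏ j ∈ Finset.range k, v j) * (v k - u k) := by
      rw [Finset.prod_range_succ, Finset.prod_range_succ]; ring
    rw [e]
    refine padicNorm_sub_le ?_ ?_
    · simpa using padicNorm_mul_le
        (ih (fun j hj ↦ hu j (by omega)) (fun j hj ↦ hv j (by omega)) fun j hj ↦ huv j (by omega))
        (hu k k.lt_succ_self)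
    · rw [← neg_sub (u k), mul_neg, padicNorm.neg]
      simpa using padicNorm_mul_le
        (padicNorm_prod_le_one fun j hj ↦ hv j (by have := Finset.mem_range.1 hj; omega))
        (huv k k.lt_succ_self)

theorem padicNorm_sub_eq_one {B e : ℚ} (hB : padicNorm p B = 1) (he : padicNorm p e < 1) :
    padicNorm p (B - e) = 1 := by
  rw [sub_eq_add_neg, padicNorm.add_eq_max_of_ne (by rw [padicNorm.neg, hB]; exact he.ne'),
    padicNorm.neg, hB, max_eq_left he.le]

theorem padicNorm_perturbed_div_le_one {A B c e : ℚ} (hA : padicNorm p A ≤ 1)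
    (hB : padicNorm p B = 1) (hc : padicNorm p c ≤ 1) (he : padicNorm p e < 1) :
    padicNorm p ((A - e) / (B - c * e)) ≤ 1 := by
  have hce : padicNorm p (c * e) < 1 :=
    (padicNorm_mul_le hc le_rfl).trans_lt (by simpa using he)
  rw [padicNorm.div, padicNorm_sub_eq_one hB hce, div_one]
  exact padicNorm_sub_le hA he.le

theorem padicNorm_div_sub_perturbed_div_le {A B c e : ℚ} (hA : padicNorm p A ≤ 1)
    (hB : padicNorm p B = 1) (hc : padicNorm p c ≤ 1) (he : padicNorm p e < 1) :
    padicNorm p (A / B - (A - e) / (B - c * e)) ≤ padicNorm p e := by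
  have hce : padicNorm p (c * e) < 1 :=
    (padicNorm_mul_le hc le_rfl).trans_lt (by simpa using he)
  have hBe := padicNorm_sub_eq_one hB hce
  have hB0 : B ≠ 0 := by rintro rfl; simp at hB
  have hBe0 : B - c * e ≠ 0 := by intro h; simp [h] at hBe
  have e1 : A / B - (A - e) / (B - c * e) = (B - c * A) * e / (B * (B - c * e)) := by
    rw [div_sub_div _ _ hB0 hBe0]
    ring
  rw [e1, padicNorm.div, padicNorm.mul B, hB, hBe, one_mul, div_one]
  have hcA : padicNorm p (c * A) ≤ 1 := by simpa using padicNorm_mul_le hc hA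
  simpa using padicNorm_mul_le (padicNorm_sub_le hB.le hcA) (le_refl (padicNorm p e))

end PadicNorm

theorem padicNorm_natCast_eq_one {p : ℕ} [Fact p.Prime] {n : ℕ} (h0 : 0 < n) (h : n < p) :
    padicNorm p n = 1 :=
  (padicNorm.nat_eq_one_iff n).2 (Nat.not_dvd_of_pos_of_lt h0 h)

theorem padicNorm_two_eq_one {p : ℕ} [Fact p.Prime] (hodd : Odd p) : padicNorm p 2 = 1 := by
  have := (Fact.out : p.Prime).two_le
  have := Nat.odd_iff.1 hodd
  exact_mod_cast padicNorm_natCast_eq_one two_pos (show 2 < p by omega)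

theorem padicNorm_four_eq_one {p : ℕ} [Fact p.Prime] (hodd : Odd p) : padicNorm p 4 = 1 := by
  have : (4 : ℚ) = 2 * 2 := by norm_num
  rw [this, padicNorm.mul, padicNorm_two_eq_one hodd, one_mul]

theorem inv_prime_sq_lt_one {p : ℕ} [Fact p.Prime] : ((p : ℚ) ^ 2)⁻¹ < 1 :=
  inv_lt_one_of_one_lt₀ (one_lt_pow₀ (by exact_mod_cast (Fact.out : p.Prime).one_lt) two_ne_zero)

theorem padicNorm_deformedSum_le {p : ℕ} [Fact p.Prime] (hodd : Odd p) {m : ℕ}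
    (hm : 4 * m + 1 = 3 * p) {x : ℚ} (hx : padicNorm p (x ^ 2) ≤ ((p : ℚ) ^ 2)⁻¹)
    (hx' : ∀ k : ℕ, (k + 1 : ℚ) ^ 2 - 1 / 4 * x ^ 2 ≠ 0) :
    padicNorm p (deformedSum x (m + 1 / 4) p) ≤ ((p : ℚ) ^ 3)⁻¹ := by
  have hp2 := (Fact.out : p.Prime).two_le
  obtain ⟨l, hl⟩ := hodd
  rw [deformedSum_eq_prod (by omega) hx',
    ← Finset.mul_prod_erase _ _ (Finset.mem_range.2 (show l < m by omega))]
  have hx1 : padicNorm p (x ^ 2) < 1 := hx.trans_lt inv_prime_sq_lt_one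
  have hden (j : ℕ) (hj : j < m) : padicNorm p ((2 * j + 2 : ℚ) ^ 2) = 1 := by
    have h : padicNorm p ((2 * j + 2 : ℕ) : ℚ) = 1 := by
      rw [padicNorm.nat_eq_one_iff]
      rintro ⟨c, hc⟩
      have hc2 : c < 2 := by
        by_contra! h2
        have := Nat.mul_le_mul_left p h2
        omega
      interval_cases c <;> omega
    push_cast at h
    rw [sq, padicNorm.mul, h, one_mul]
  have hnum (j : ℕ) : padicNorm p ((2 * j + 1 : ℚ) ^ 2) ≤ 1 := by
    exact_mod_cast padicNorm.of_nat (p := p) ((2 * j + 1) ^ 2)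
  have hfac (j : ℕ) (hj : j < m) :
      padicNorm p (((2 * j + 1) ^ 2 - x ^ 2) / ((2 * j + 2) ^ 2 - x ^ 2)) ≤ 1 := by
    simpa using padicNorm_perturbed_div_le_one (c := 1) (hnum j) (hden j hj) (by simp) hx1
  have h1 : padicNorm p (4 * m + 1 : ℚ) ≤ (p : ℚ)⁻¹ := by
    have e : (4 * m + 1 : ℚ) = 3 * p := by exact_mod_cast hm
    rw [e, padicNorm.mul, padicNorm.padicNorm_p_of_prime]
    refine mul_le_of_le_one_left (by positivity) ?_
    exact_mod_cast padicNorm.of_nat (p := p) 3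
  have h2 : padicNorm p (((2 * l + 1) ^ 2 - x ^ 2) / ((2 * l + 2) ^ 2 - x ^ 2)) ≤
      ((p : ℚ) ^ 2)⁻¹ := by
    rw [padicNorm.div, padicNorm_sub_eq_one (hden l (by omega)) hx1, div_one]
    refine padicNorm_sub_le ?_ hx
    have e : (2 * l + 1 : ℚ) = p := by exact_mod_cast hl.symm
    rw [e, sq, padicNorm.mul, padicNorm.padicNorm_p_of_prime, ← mul_inv, ← sq]
  have h3 := padicNorm_prod_le_one (p := p) (s := (Finset.range m).erase l) fun j hj ↦
    hfac j (Finset.mem_range.1 (Finset.mem_of_mem_erase hj))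
  refine (padicNorm_mul_le h1 (padicNorm_mul_le h2 h3)).trans_eq ?_
  rw [mul_one, ← mul_inv, ← pow_succ']

theorem padicNorm_deformedSum_second_difference_le {p : ℕ} [Fact p.Prime] (hodd : Odd p) {x y : ℚ}
    (hx : padicNorm p (x ^ 2) ≤ ((p : ℚ) ^ 2)⁻¹) (hy : padicNorm p (y ^ 2) ≤ ((p : ℚ) ^ 2)⁻¹) :
    padicNorm p (deformedSum 0 0 p - deformedSum x 0 p - deformedSum 0 y p + deformedSum x y p) ≤
      ((p : ℚ) ^ 4)⁻¹ := by
  have hε : (0 : ℚ) ≤ ((p : ℚ) ^ 2)⁻¹ := by positivity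
  have h2 := padicNorm_two_eq_one hodd
  have h4 := padicNorm_four_eq_one hodd
  have hx1 := hx.trans_lt inv_prime_sq_lt_one
  have hy1 := hy.trans_lt inv_prime_sq_lt_one
  have hc : padicNorm p (1 / 4) ≤ 1 := by rw [padicNorm.div, h4, padicNorm.one, div_one]
  have hhalf (j : ℕ) : padicNorm p (1 / 2 + j : ℚ) ≤ 1 := by
    have e : (1 / 2 + j : ℚ) = (1 + 2 * j : ℕ) / 2 := by push_cast; ring
    rw [e, padicNorm.div, h2, div_one]
    exact padicNorm.of_nat _
  have hquarter (j : ℕ) : padicNorm p (1 / 4 + j : ℚ) ≤ 1 := by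
    have e : (1 / 4 + j : ℚ) = (1 + 4 * j : ℕ) / 4 := by push_cast; ring
    rw [e, padicNorm.div, h4, div_one]
    exact padicNorm.of_nat _
  have hsq {a : ℚ} (ha : padicNorm p a ≤ 1) : padicNorm p (a ^ 2) ≤ 1 := by
    simpa [sq] using padicNorm_mul_le ha ha
  have hden {j : ℕ} (hj : j < p - 1) : padicNorm p (j + 1 : ℚ) = 1 := by
    exact_mod_cast padicNorm_natCast_eq_one j.succ_pos (show j + 1 < p by omega)
  have hdensq {j : ℕ} (hj : j < p - 1) : padicNorm p ((j + 1 : ℚ) ^ 2) = 1 := by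
    rw [sq, padicNorm.mul, hden hj, one_mul]
  set f : ℕ → ℚ := fun j ↦ (1 / 2 + j) / (j + 1) with hf
  set g : ℚ → ℕ → ℚ := fun z j ↦ ((1 / 2 + j) ^ 2 - z ^ 2) / ((j + 1) ^ 2 - 1 / 4 * z ^ 2) with hg
  set h : ℚ → ℕ → ℚ := fun z j ↦ ((1 / 4 + j) ^ 2 - z ^ 2) / ((j + 1) ^ 2 - 4 * z ^ 2) with hh
  have hsum (z w : ℚ) : deformedSum z w p = ∑ k ∈ Finset.range p, (6 * k + 1 : ℚ) *
      ((∏ j ∈ Finset.range k, f j) * (∏ j ∈ Finset.range k, g z j) *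
        ∏ j ∈ Finset.range k, h w j) := by
    simp only [deformedSum, ← Finset.prod_mul_distrib]
    refine Finset.sum_congr rfl fun k _ ↦ congrArg _ (Finset.prod_congr rfl fun j _ ↦ ?_)
    simp only [termRatio, hf, hg, hh]
    ring
  rw [hsum, hsum, hsum, hsum, ← Finset.sum_sub_distrib, ← Finset.sum_sub_distrib,
    ← Finset.sum_add_distrib]
  refine padicNorm.sum_le' (fun k hk ↦ ?_) (by positivity)
  have hj {j : ℕ} (h : j < k) : j < p - 1 := by have := Finset.mem_range.1 hk; omega
  have e (c F G₀ G H₀ H : ℚ) : c * (F * G₀ * H₀) - c * (F * G * H₀) - c * (F * G₀ * H) +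
      c * (F * G * H) = c * (F * ((G₀ - G) * (H₀ - H))) := by ring
  have hcoef : padicNorm p (6 * k + 1 : ℚ) ≤ 1 := by
    exact_mod_cast padicNorm.of_nat (p := p) (6 * k + 1)
  have hF : padicNorm p (∏ j ∈ Finset.range k, f j) ≤ 1 :=
    padicNorm_prod_le_one fun j hjk ↦ by
      rw [hf, padicNorm.div, hden (hj (Finset.mem_range.1 hjk)), div_one]
      exact hhalf j
  have hG : padicNorm p (∏ j ∈ Finset.range k, g 0 j - ∏ j ∈ Finset.range k, g x j) ≤
      ((p : ℚ) ^ 2)⁻¹ :=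
    padicNorm_prod_sub_prod_le hε
      (fun j hjk ↦ padicNorm_perturbed_div_le_one (hsq (hhalf j)) (hdensq (hj hjk)) hc (by simp))
      (fun j hjk ↦ padicNorm_perturbed_div_le_one (hsq (hhalf j)) (hdensq (hj hjk)) hc hx1)
      (fun j hjk ↦ by
        simpa [hg] using (padicNorm_div_sub_perturbed_div_le (hsq (hhalf j)) (hdensq (hj hjk))
          hc hx1).trans hx)
  have hH : padicNorm p (∏ j ∈ Finset.range k, h 0 j - ∏ j ∈ Finset.range k, h y j) ≤
      ((p : ℚ) ^ 2)⁻¹ :=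
    padicNorm_prod_sub_prod_le hε
      (fun j hjk ↦ padicNorm_perturbed_div_le_one (hsq (hquarter j)) (hdensq (hj hjk)) h4.le
        (by simp))
      (fun j hjk ↦ padicNorm_perturbed_div_le_one (hsq (hquarter j)) (hdensq (hj hjk)) h4.le hy1)
      (fun j hjk ↦ by
        simpa [hh] using (padicNorm_div_sub_perturbed_div_le (hsq (hquarter j)) (hdensq (hj hjk))
          h4.le hy1).trans hy)
  rw [e]
  refine (padicNorm_mul_le hcoef (padicNorm_mul_le hF (padicNorm_mul_le hG hH))).trans_eq ?_
  rw [one_mul, one_mul, ← mul_inv, ← pow_add]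

theorem stmt_2 (p : ℕ) [Fact p.Prime] (hodd : Odd p) (hp4 : p % 4 = 3) :
    ‖((∑ k ∈ Finset.range p,
        (6 * k + 1 : ℚ) * risingFac (1/2) k ^ 3 * risingFac (1/4) k ^ 2 /
          (k.factorial : ℚ) ^ 5 : ℚ) : ℚ_[p])‖ ≤ (p : ℝ) ^ (-3 : ℤ) := by
  obtain ⟨t, ht⟩ : ∃ t, p = 4 * t + 3 := ⟨p / 4, by omega⟩
  have hpc : (p : ℚ) = 4 * t + 3 := by exact_mod_cast ht
  have hp1 : (1 : ℚ) ≤ p := by exact_mod_cast (Fact.out : p.Prime).one_le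
  have hnorm (c : ℕ) (d : ℚ) (hd : padicNorm p d = 1) :
      padicNorm p ((c * p / d) ^ 2) ≤ ((p : ℚ) ^ 2)⁻¹ := by
    have h : padicNorm p (c * p / d) ≤ (p : ℚ)⁻¹ := by
      rw [padicNorm.div, hd, div_one, padicNorm.mul, padicNorm.padicNorm_p_of_prime]
      exact mul_le_of_le_one_left (by positivity) (padicNorm.of_nat c)
    rw [sq, sq, mul_inv]
    exact padicNorm_mul_le h h
  have hx : padicNorm p ((p / 2 : ℚ) ^ 2) ≤ ((p : ℚ) ^ 2)⁻¹ := by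
    simpa using hnorm 1 2 (padicNorm_two_eq_one hodd)
  have hy : padicNorm p ((3 * p / 4 : ℚ) ^ 2) ≤ ((p : ℚ) ^ 2)⁻¹ :=
    hnorm 3 4 (padicNorm_four_eq_one hodd)
  have hx' (k : ℕ) : (k + 1 : ℚ) ^ 2 - 1 / 4 * (p / 2 : ℚ) ^ 2 ≠ 0 := by
    intro h
    have h' : ((4 * (k + 1)) ^ 2 : ℚ) = (p : ℚ) ^ 2 := by linarith
    have h'' : 4 * (k + 1) = p := by
      have : (4 * (k + 1)) ^ 2 = p ^ 2 := by exact_mod_cast h'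
      exact Nat.pow_left_injective two_ne_zero this
    omega
  have ey : (3 * p / 4 : ℚ) = (3 * t + 2 : ℕ) + 1 / 4 := by rw [hpc]; push_cast; ring
  have ex : (p / 2 : ℚ) = 2 * t + 3 / 2 := by rw [hpc]; ring
  have hm : 4 * (3 * t + 2) + 1 = 3 * p := by omega
  have hx0 : deformedSum (p / 2) 0 p = 0 := by
    rw [ex]
    exact deformedSum_eq_zero (by omega)
  have h0y : padicNorm p (deformedSum 0 (3 * p / 4) p) ≤ ((p : ℚ) ^ 3)⁻¹ := by
    rw [ey]
    refine padicNorm_deformedSum_le hodd hm (by simp) fun k ↦ ?_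
    rw [zero_pow two_ne_zero, mul_zero, sub_zero]
    positivity
  have hxy : padicNorm p (deformedSum (p / 2) (3 * p / 4) p) ≤ ((p : ℚ) ^ 3)⁻¹ := by
    rw [ey]
    exact padicNorm_deformedSum_le hodd hm hx hx'
  have hdiff := (padicNorm_deformedSum_second_difference_le hodd hx hy).trans
    (inv_anti₀ (by positivity) (pow_le_pow_right₀ hp1 (show 3 ≤ 4 by norm_num)))
  have hmain : padicNorm p (deformedSum 0 0 p) ≤ ((p : ℚ) ^ 3)⁻¹ := by
    have e (a b c d : ℚ) : a = (a - b - c + d) - (d - c - b) := by ring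
    rw [e (deformedSum 0 0 p) (deformedSum (p / 2) 0 p) (deformedSum 0 (3 * p / 4) p)
      (deformedSum (p / 2) (3 * p / 4) p)]
    refine padicNorm_sub_le hdiff ?_
    rw [hx0, sub_zero]
    exact padicNorm_sub_le hxy h0y
  have hsum : ∑ k ∈ Finset.range p, (6 * k + 1 : ℚ) * risingFac (1/2) k ^ 3 *
      risingFac (1/4) k ^ 2 / (k.factorial : ℚ) ^ 5 = deformedSum 0 0 p := by
    refine Finset.sum_congr rfl fun k _ ↦ ?_
    rw [← risingFac_term_eq_prod_termRatio]
    ring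
  rw [hsum, Padic.eq_padicNorm, zpow_neg]
  have hreal : ((padicNorm p (deformedSum 0 0 p) : ℚ) : ℝ) ≤ ((((p : ℚ) ^ 3)⁻¹ : ℚ) : ℝ) :=
    Rat.cast_le.2 hmain
  push_cast at hreal
  exact_mod_cast hreal
end
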